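/- Let 𝔤 be an n-dimensional real Lie algebra that lies in the Zariski closure of the GL(n,ℝ)-orbit of a law isomorphic to 𝔤₀ (i.e., 𝔤₀ degenerates to 𝔤). Then dim H^p(𝔤, ℝ) ≥ dim H^p(𝔤₀, ℝ) for all p ≥ 0; in particular the first Betti number b₁ does not decrease under degeneration. -/

import Mathlib

noncomputable section

/-- The space of skew-symmetric bilinear "laws" on `ℝⁿ` (Lie algebra laws once the
Jacobi identity and alternation hold). -/
abbrev LieLawSpace (n : ℕ) := (Fin n → ℝ) →ₗ[ℝ] (Fin n → ℝ) →ₗ[ℝ] (Fin n → ℝ)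

/-- `lam` is a Lie algebra law: alternating and satisfying the Jacobi identity. -/
def IsLieLaw {n : ℕ} (lam : LieLawSpace n) : Prop :=
  (∀ X, lam X X = 0) ∧
    ∀ X Y Z, lam (lam X Y) Z + lam (lam Y Z) X + lam (lam Z X) Y = 0

/-- Structure constants of a law in the standard basis. -/
def lawCoeff {n : ℕ} (lam : LieLawSpace n) : Fin n × Fin n × Fin n → ℝ :=
  fun q => lam (Pi.single q.1 1) (Pi.single q.2.1 1) q.2.2

/-- Zariski closure of a set of laws: common vanishing locus of all polynomials (in the
structure constants) vanishing on the set. -/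
def zariskiClosure {n : ℕ} (S : Set (LieLawSpace n)) : Set (LieLawSpace n) :=
  {lam | ∀ p : MvPolynomial (Fin n × Fin n × Fin n) ℝ,
    (∀ m ∈ S, MvPolynomial.eval (lawCoeff m) p = 0) →
      MvPolynomial.eval (lawCoeff lam) p = 0}

/-- The `GL(n,ℝ)`-orbit of a law, for the action `(g·λ)(X,Y) = g (λ (g⁻¹X) (g⁻¹Y))`. -/
def lawOrbit {n : ℕ} (lam : LieLawSpace n) : Set (LieLawSpace n) :=
  {m | ∃ g : (Fin n → ℝ) ≃ₗ[ℝ] (Fin n → ℝ),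
    ∀ X Y, m X Y = g (lam (g.symm X) (g.symm Y))}

/-- Index bookkeeping: the `(kv-1)`-th element (in increasing order) of the complement of
`{i, j}` (with `i < j`) in `{0, …, q}`. -/
def ceIdx (i j kv : ℕ) : ℕ :=
  if kv - 1 < i then kv - 1 else if kv < j then kv else kv + 1

/-- The Chevalley–Eilenberg differential (trivial coefficients) of a `q`-cochain,
as a function on `(q+1)`-tuples:
`(dω)(x₀,…,x_q) = ∑_{i<j} (-1)^{i+j} ω(λ(x_i,x_j), x₀, …, x̂_i, …, x̂_j, …, x_q)`. -/
def ceDiff {n : ℕ} (q : ℕ) (lam : LieLawSpace n) (ω : (Fin q → (Fin n → ℝ)) → ℝ) :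
    (Fin (q + 1) → (Fin n → ℝ)) → ℝ :=
  fun x => ∑ i : Fin (q + 1), ∑ j : Fin (q + 1),
    if i < j then
      (-1 : ℝ) ^ (i.val + j.val) *
        ω (fun k => if k.val = 0 then lam (x i) (x j)
            else x ⟨ceIdx i.val j.val k.val % (q + 1), Nat.mod_lt _ (Nat.succ_pos q)⟩)
    else 0

theorem ceDiff_add {n : ℕ} (q : ℕ) (lam : LieLawSpace n)
    (f g : (Fin q → (Fin n → ℝ)) → ℝ) (x : Fin (q + 1) → (Fin n → ℝ)) :
    ceDiff q lam (f + g) x = ceDiff q lam f x + ceDiff q lam g x := by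
  unfold ceDiff
  rw [← Finset.sum_add_distrib]
  refine Finset.sum_congr rfl fun i _ => ?_
  rw [← Finset.sum_add_distrib]
  refine Finset.sum_congr rfl fun j _ => ?_
  by_cases h : i < j
  · simp only [if_pos h, Pi.add_apply, mul_add]
  · simp only [if_neg h, add_zero]

theorem ceDiff_smul {n : ℕ} (q : ℕ) (lam : LieLawSpace n) (c : ℝ)
    (f : (Fin q → (Fin n → ℝ)) → ℝ) (x : Fin (q + 1) → (Fin n → ℝ)) :
    ceDiff q lam (c • f) x = c * ceDiff q lam f x := by
  unfold ceDiff
  rw [Finset.mul_sum]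
  refine Finset.sum_congr rfl fun i _ => ?_
  rw [Finset.mul_sum]
  refine Finset.sum_congr rfl fun j _ => ?_
  by_cases h : i < j
  · simp only [if_pos h, Pi.smul_apply, smul_eq_mul]; ring
  · simp only [if_neg h, mul_zero]

theorem ceDiff_zero {n : ℕ} (q : ℕ) (lam : LieLawSpace n)
    (x : Fin (q + 1) → (Fin n → ℝ)) :
    ceDiff q lam (0 : (Fin q → (Fin n → ℝ)) → ℝ) x = 0 := by
  unfold ceDiff
  refine Finset.sum_eq_zero fun i _ => Finset.sum_eq_zero fun j _ => ?_
  by_cases h : i < j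
  · simp [h]
  · simp [h]

/-- The `p`-cocycles of the Chevalley–Eilenberg complex with trivial coefficients. -/
def ceCocycles (n q : ℕ) (lam : LieLawSpace n) :
    Submodule ℝ (AlternatingMap ℝ (Fin n → ℝ) ℝ (Fin q)) where
  carrier := {ω | ∀ x, ceDiff q lam ⇑ω x = 0}
  add_mem' := by
    intro a b ha hb x
    have hc : (⇑(a + b) : (Fin q → (Fin n → ℝ)) → ℝ) = ⇑a + ⇑b := by
      funext v; simp
    rw [hc, ceDiff_add, ha x, hb x, add_zero]
  zero_mem' := by
    intro x
    have hc : (⇑(0 : AlternatingMap ℝ (Fin n → ℝ) ℝ (Fin q)) :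
        (Fin q → (Fin n → ℝ)) → ℝ) = 0 := by funext v; simp
    rw [hc, ceDiff_zero]
  smul_mem' := by
    intro c a ha x
    have hc : (⇑(c • a) : (Fin q → (Fin n → ℝ)) → ℝ) = c • ⇑a := by
      funext v; simp
    rw [hc, ceDiff_smul, ha x, mul_zero]

/-- The `p`-coboundaries of the Chevalley–Eilenberg complex with trivial coefficients. -/
def ceCoboundaries (n : ℕ) :
    (q : ℕ) → LieLawSpace n → Submodule ℝ (AlternatingMap ℝ (Fin n → ℝ) ℝ (Fin q))
  | 0, _ => ⊥
  | q + 1, lam =>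
    { carrier := {ω | ∃ η : AlternatingMap ℝ (Fin n → ℝ) ℝ (Fin q),
        ∀ x, ω x = ceDiff q lam ⇑η x}
      add_mem' := by
        rintro a b ⟨ηa, ha⟩ ⟨ηb, hb⟩
        refine ⟨ηa + ηb, fun x => ?_⟩
        have hc : (⇑(ηa + ηb) : (Fin q → (Fin n → ℝ)) → ℝ) = ⇑ηa + ⇑ηb := by
          funext v; simp
        rw [hc, ceDiff_add, ← ha x, ← hb x]
        simp
      zero_mem' := by
        refine ⟨0, fun x => ?_⟩
        have hc : (⇑(0 : AlternatingMap ℝ (Fin n → ℝ) ℝ (Fin q)) :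
            (Fin q → (Fin n → ℝ)) → ℝ) = 0 := by funext v; simp
        rw [hc, ceDiff_zero]
        simp
      smul_mem' := by
        rintro c a ⟨η, ha⟩
        refine ⟨c • η, fun x => ?_⟩
        have hc : (⇑(c • η) : (Fin q → (Fin n → ℝ)) → ℝ) = c • ⇑η := by
          funext v; simp
        rw [hc, ceDiff_smul, ← ha x]
        simp }

/-- The `p`-th Betti number of a law: `dim Z^p - dim B^p = dim H^p(𝔤, ℝ)`. -/
def lawBetti (n p : ℕ) (lam : LieLawSpace n) : ℕ :=
  Module.finrank ℝ (ceCocycles n p lam) - Module.finrank ℝ (ceCoboundaries n p lam)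


section Aux

open Module

instance altFinite (n q : ℕ) :
    Module.Finite ℝ (AlternatingMap ℝ (Fin n → ℝ) ℝ (Fin q)) :=
  Module.Finite.of_injective
    (AlternatingMap.toMultilinearMapLM (S := ℝ) :
      AlternatingMap ℝ (Fin n → ℝ) ℝ (Fin q) →ₗ[ℝ] _)
    AlternatingMap.coe_multilinearMap_injective

/-- The argument tuple in the differential is an update in the first coordinate. -/
theorem ceDiff_add_law {n : ℕ} (q : ℕ) (l m : LieLawSpace n)
    (ω : AlternatingMap ℝ (Fin n → ℝ) ℝ (Fin q)) (x : Fin (q + 1) → (Fin n → ℝ)) :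
    ceDiff q (l + m) ω x = ceDiff q l ω x + ceDiff q m ω x := by
  unfold ceDiff
  rw [← Finset.sum_add_distrib]
  refine Finset.sum_congr rfl fun i _ => ?_
  rw [← Finset.sum_add_distrib]
  refine Finset.sum_congr rfl fun j _ => ?_
  by_cases h : i < j
  · simp only [if_pos h, ← mul_add]
    congr 1
    cases q with
    | zero => omega
    | succ r =>
      have key : ∀ (v : Fin n → ℝ), (fun k : Fin (r + 1) => if k.val = 0 then v
            else x ⟨ceIdx i.val j.val k.val % (r + 1 + 1), Nat.mod_lt _ (Nat.succ_pos _)⟩) =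
          Function.update (fun k : Fin (r + 1) =>
            x ⟨ceIdx i.val j.val k.val % (r + 1 + 1), Nat.mod_lt _ (Nat.succ_pos _)⟩) 0 v := by
        intro v
        funext k
        by_cases hk : k = 0
        · subst hk; simp
        · have : k.val ≠ 0 := fun h => hk (Fin.ext h)
          simp [hk]
      rw [key, key, key, LinearMap.add_apply, LinearMap.add_apply, AlternatingMap.map_update_add]
  · simp only [if_neg h, add_zero]

theorem ceDiff_smul_law {n : ℕ} (q : ℕ) (c : ℝ) (l : LieLawSpace n)
    (ω : AlternatingMap ℝ (Fin n → ℝ) ℝ (Fin q)) (x : Fin (q + 1) → (Fin n → ℝ)) :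
    ceDiff q (c • l) ω x = c * ceDiff q l ω x := by
  unfold ceDiff
  rw [Finset.mul_sum]
  refine Finset.sum_congr rfl fun i _ => ?_
  rw [Finset.mul_sum]
  refine Finset.sum_congr rfl fun j _ => ?_
  by_cases h : i < j
  · simp only [if_pos h]
    cases q with
    | zero => omega
    | succ r =>
      have key : ∀ (v : Fin n → ℝ), (fun k : Fin (r + 1) => if k.val = 0 then v
            else x ⟨ceIdx i.val j.val k.val % (r + 1 + 1), Nat.mod_lt _ (Nat.succ_pos _)⟩) =
          Function.update (fun k : Fin (r + 1) =>
            x ⟨ceIdx i.val j.val k.val % (r + 1 + 1), Nat.mod_lt _ (Nat.succ_pos _)⟩) 0 v := by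
        intro v
        funext k
        by_cases hk : k = 0
        · subst hk; simp
        · have : k.val ≠ 0 := fun h => hk (Fin.ext h)
          simp [hk]
      rw [key, key, LinearMap.smul_apply, LinearMap.smul_apply, AlternatingMap.map_update_smul,
        smul_eq_mul]
      ring
  · simp only [if_neg h, mul_zero]

/-- The differential as a bilinear map in the law and the cochain. -/
def ceD (n q : ℕ) : LieLawSpace n →ₗ[ℝ] AlternatingMap ℝ (Fin n → ℝ) ℝ (Fin q) →ₗ[ℝ]
    ((Fin (q + 1) → (Fin n → ℝ)) → ℝ) :=
  LinearMap.mk₂ ℝ (fun l ω => ceDiff q l ω)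
    (fun l m ω => by funext x; exact ceDiff_add_law q l m ω x)
    (fun c l ω => by funext x; exact ceDiff_smul_law q c l ω x)
    (fun l ω η => by
      funext x
      have hc : (⇑(ω + η) : (Fin q → (Fin n → ℝ)) → ℝ) = ⇑ω + ⇑η := by funext v; simp
      rw [hc, ceDiff_add]; rfl)
    (fun c l ω => by
      funext x
      have hc : (⇑(c • ω) : (Fin q → (Fin n → ℝ)) → ℝ) = c • ⇑ω := by funext v; simp
      rw [hc, ceDiff_smul]; rfl)

theorem ceD_apply (n q : ℕ) (l : LieLawSpace n) (ω : AlternatingMap ℝ (Fin n → ℝ) ℝ (Fin q)) :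
    ceD n q l ω = ceDiff q l ω := rfl

theorem ker_ceD (n q : ℕ) (l : LieLawSpace n) : LinearMap.ker (ceD n q l) = ceCocycles n q l := by
  ext ω
  rw [LinearMap.mem_ker, ceD_apply]
  exact funext_iff

/-- Structure constants as a linear map. -/
def lawCoeffL (n : ℕ) : LieLawSpace n →ₗ[ℝ] (Fin n × Fin n × Fin n → ℝ) where
  toFun := lawCoeff
  map_add' _ _ := rfl
  map_smul' _ _ := rfl

theorem lawCoeffL_inj (n : ℕ) : LinearMap.ker (lawCoeffL n) = ⊥ := by
  rw [LinearMap.ker_eq_bot']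
  intro l hl
  refine LinearMap.pi_ext' fun i => LinearMap.ext_ring (LinearMap.pi_ext' fun j =>
    LinearMap.ext_ring ?_)
  funext k
  exact congrFun hl (i, j, k)

/-- A linear functional on laws is a polynomial in the structure constants. -/
theorem exists_poly (n : ℕ) (f : LieLawSpace n →ₗ[ℝ] ℝ) :
    ∃ p : MvPolynomial (Fin n × Fin n × Fin n) ℝ,
      ∀ l, MvPolynomial.eval (lawCoeff l) p = f l := by
  obtain ⟨g, hg⟩ : ∃ g : (Fin n × Fin n × Fin n → ℝ) →ₗ[ℝ] LieLawSpace n,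
      g ∘ₗ lawCoeffL n = LinearMap.id :=
    LinearMap.exists_leftInverse_of_injective (V := LieLawSpace n)
      (V' := Fin n × Fin n × Fin n → ℝ) (lawCoeffL n) (lawCoeffL_inj n)
  refine ⟨∑ s, MvPolynomial.C (f (g (Pi.single s 1))) * MvPolynomial.X s, fun l => ?_⟩
  have h1 : f l = (f ∘ₗ g) (lawCoeff l) := by
    have := LinearMap.congr_fun hg l
    exact congrArg f this.symm
  rw [h1, LinearMap.pi_apply_eq_sum_univ]
  simp only [map_sum, map_mul, MvPolynomial.eval_C, MvPolynomial.eval_X, smul_eq_mul]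
  refine Finset.sum_congr rfl fun s _ => ?_
  rw [mul_comm]
  congr 1
  have hs : (Pi.single s 1 : Fin n × Fin n × Fin n → ℝ) = fun t => if s = t then 1 else 0 := by
    funext t
    simp [Pi.single_apply, eq_comm]
  rw [hs]
  rfl

/-- Semicontinuity of kernels for linear families. -/
theorem semicont {n : ℕ} {V W : Type*} [AddCommGroup V] [Module ℝ V] [Module.Finite ℝ V]
    [AddCommGroup W] [Module ℝ W] (D : LieLawSpace n →ₗ[ℝ] V →ₗ[ℝ] W)
    (S : Set (LieLawSpace n)) (mu : LieLawSpace n) (h : mu ∈ zariskiClosure S) :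
    ∃ m ∈ S, finrank ℝ (LinearMap.ker (D m)) ≤ finrank ℝ (LinearMap.ker (D mu)) := by
  obtain ⟨C, hC⟩ := Submodule.exists_isCompl (LinearMap.ker (D mu))
  have hinj : LinearMap.ker (D mu ∘ₗ C.subtype) = ⊥ := by
    rw [LinearMap.ker_eq_bot']
    intro c hc
    have : (c : V) ∈ LinearMap.ker (D mu) ⊓ C := ⟨hc, c.2⟩
    rw [hC.inf_eq_bot] at this
    exact Subtype.ext this
  obtain ⟨L, hL⟩ := LinearMap.exists_leftInverse_of_injective _ hinj
  let b := Module.finBasis ℝ C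
  have hp : ∀ i j, ∃ p : MvPolynomial (Fin n × Fin n × Fin n) ℝ,
      ∀ l, MvPolynomial.eval (lawCoeff l) p =
        LinearMap.toMatrix b b (L ∘ₗ D l ∘ₗ C.subtype) i j := by
    intro i j
    obtain ⟨p, hp⟩ := exists_poly n (b.coord i ∘ₗ L ∘ₗ D.flip (b j : V))
    refine ⟨p, fun l => ?_⟩
    rw [hp, LinearMap.toMatrix_apply]
    rfl
  choose P hP using hp
  have hdet : ∀ l, MvPolynomial.eval (lawCoeff l) (Matrix.det (Matrix.of P)) =
      LinearMap.det (L ∘ₗ D l ∘ₗ C.subtype) := by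
    intro l
    rw [RingHom.map_det, ← LinearMap.det_toMatrix b]
    congr 1
    ext i j
    exact hP i j l
  by_contra! hcon
  have h1 := h (Matrix.det (Matrix.of P)) (fun m hm => by
    by_contra hne
    rw [hdet] at hne
    have hlt := hcon m hm
    have hk : LinearMap.ker (L ∘ₗ D m ∘ₗ C.subtype) = ⊥ := by
      by_contra hk
      exact hne (LinearMap.det_eq_zero_iff_ker_ne_bot.2 hk)
    have hdis : Disjoint (LinearMap.ker (D m)) C := by
      rw [Submodule.disjoint_def]
      intro v hv hvC
      have : (⟨v, hvC⟩ : C) ∈ LinearMap.ker (L ∘ₗ D m ∘ₗ C.subtype) := by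
        rw [LinearMap.mem_ker] at hv ⊢
        simp [hv]
      rw [hk] at this
      exact congrArg Subtype.val this
    have h2 := Submodule.finrank_add_finrank_le_of_disjoint hdis
    have h3 := Submodule.finrank_add_eq_of_isCompl hC
    omega)
  rw [hdet] at h1
  have h2 : L ∘ₗ D mu ∘ₗ C.subtype = LinearMap.id := hL
  rw [h2, LinearMap.det_id] at h1
  exact one_ne_zero h1

/-- Naturality of the differential along the orbit. -/
theorem ceDiff_orbit {n q : ℕ} {l m : LieLawSpace n} (g : (Fin n → ℝ) ≃ₗ[ℝ] (Fin n → ℝ))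
    (hg : ∀ X Y, m X Y = g (l (g.symm X) (g.symm Y)))
    (ω : AlternatingMap ℝ (Fin n → ℝ) ℝ (Fin q)) (x : Fin (q + 1) → (Fin n → ℝ)) :
    ceDiff q l (ω.compLinearMap g.toLinearMap) x = ceDiff q m ω (fun k => g (x k)) := by
  unfold ceDiff
  refine Finset.sum_congr rfl fun i _ => Finset.sum_congr rfl fun j _ => ?_
  by_cases h : i < j
  · simp only [if_pos h]
    congr 1
    rw [AlternatingMap.compLinearMap_apply]
    congr 1
    funext k
    by_cases hk : k.val = 0
    · simp [hk, hg]
    · simp [hk]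
  · simp only [if_neg h]

theorem finrank_orbit {n q : ℕ} {l m : LieLawSpace n} (hm : m ∈ lawOrbit l) :
    finrank ℝ (ceCocycles n q l) = finrank ℝ (ceCocycles n q m) := by
  obtain ⟨g, hg⟩ := hm
  let e : AlternatingMap ℝ (Fin n → ℝ) ℝ (Fin q) ≃ₗ[ℝ] AlternatingMap ℝ (Fin n → ℝ) ℝ (Fin q) :=
    AlternatingMap.domLCongr ℝ ℝ (Fin q) ℝ g.symm
  have he : ∀ ω, e ω = ω.compLinearMap g.toLinearMap := fun ω => rfl
  have hmap : ceCocycles n q m = (ceCocycles n q l).comap e.toLinearMap := by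
    ext ω
    change (∀ x, ceDiff q m ω x = 0) ↔ (∀ x, ceDiff q l (e ω) x = 0)
    rw [he]
    constructor
    · intro h x
      rw [ceDiff_orbit g hg]
      exact h _
    · intro h x
      have := h (fun k => g.symm (x k))
      rw [ceDiff_orbit g hg] at this
      simpa using this
  rw [hmap]
  have h2 : (ceCocycles n q l).comap e.toLinearMap =
      (ceCocycles n q l).map e.symm.toLinearMap := by
    ext ω
    constructor
    · intro h
      exact ⟨e ω, h, e.symm_apply_apply ω⟩
    · rintro ⟨η, h, rfl⟩
      change e (e.symm η) ∈ ceCocycles n q l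
      rw [e.apply_symm_apply]
      exact h
  rw [h2]
  exact (LinearEquiv.finrank_map_eq e.symm _).symm

theorem finrank_cocycles_le {n : ℕ} (q : ℕ) {l mu : LieLawSpace n}
    (h : mu ∈ zariskiClosure (lawOrbit l)) :
    finrank ℝ (ceCocycles n q l) ≤ finrank ℝ (ceCocycles n q mu) := by
  obtain ⟨m, hm, hle⟩ := semicont (ceD n q) _ mu h
  rw [ker_ceD, ker_ceD] at hle
  rw [finrank_orbit hm]
  exact hle

/-- The term of index `(i, j)` in the differential. -/
def ceTerm {n : ℕ} (r : ℕ) (l : LieLawSpace n)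
    (ω : AlternatingMap ℝ (Fin n → ℝ) ℝ (Fin (r + 1))) (x : Fin (r + 1 + 1) → (Fin n → ℝ))
    (i j : Fin (r + 1 + 1)) : ℝ :=
  if i < j then
      (-1 : ℝ) ^ (i.val + j.val) *
        ω (fun k => if k.val = 0 then l (x i) (x j)
            else x ⟨ceIdx i.val j.val k.val % (r + 1 + 1), Nat.mod_lt _ (Nat.succ_pos _)⟩)
    else 0

theorem law_skew {n : ℕ} {l : LieLawSpace n} (hl : ∀ X, l X X = 0) (X Y : Fin n → ℝ) :
    l X Y = - l Y X := by
  have h := hl (X + Y)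
  simp only [map_add, LinearMap.add_apply, hl, zero_add, add_zero] at h
  exact eq_neg_of_add_eq_zero_right h

theorem ceTerm_key {n : ℕ} (r : ℕ) {l : LieLawSpace n} (hl : ∀ X, l X X = 0)
    (ω : AlternatingMap ℝ (Fin n → ℝ) ℝ (Fin (r + 1))) (x : Fin (r + 1 + 1) → (Fin n → ℝ))
    (i : Fin (r + 1 + 1)) (j : Fin (r + 1)) :
    (-1 : ℝ) ^ (i.val) * ((-1 : ℝ) ^ (j.val) *
      ω (Matrix.vecCons (l (x i) (x (i.succAbove j))) (j.removeNth (i.removeNth x)))) =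
    -(ceTerm r l ω x i (i.succAbove j) + ceTerm r l ω x (i.succAbove j) i) := by
  rcases lt_or_ge j.castSucc i with h | h
  · have hs : i.succAbove j = j.castSucc := Fin.succAbove_of_castSucc_lt _ _ h
    have hji : j.val < i.val := h
    have hvec : Matrix.vecCons (l (x i) (x (i.succAbove j))) (j.removeNth (i.removeNth x)) =
        Function.update (fun k : Fin (r + 1) => if k.val = 0 then l (x j.castSucc) (x i)
            else x ⟨ceIdx j.val i.val k.val % (r + 1 + 1), Nat.mod_lt _ (Nat.succ_pos _)⟩) 0
          ((-1 : ℝ) • l (x j.castSucc) (x i)) := by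
      funext k
      refine Fin.cases ?_ (fun k => ?_) k
      · simp only [Matrix.cons_val_zero, Function.update_self, hs]
        rw [law_skew hl]; simp
      · rw [Matrix.cons_val_succ, Function.update_of_ne (Fin.succ_ne_zero k)]
        simp only [Fin.val_succ, Nat.succ_ne_zero, if_false, Fin.removeNth]
        congr 1
        apply Fin.ext
        have hk := k.2
        have hi := i.2
        simp only [Fin.succAbove, Fin.lt_def, Fin.val_castSucc, ceIdx]
        split_ifs <;> simp_all [Nat.mod_eq_of_lt] <;> (try rw [Nat.mod_eq_of_lt]) <;> omega
    rw [hvec, AlternatingMap.map_update_smul]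
    have hself : Function.update (fun k : Fin (r + 1) => if k.val = 0 then l (x j.castSucc) (x i)
            else x ⟨ceIdx j.val i.val k.val % (r + 1 + 1), Nat.mod_lt _ (Nat.succ_pos _)⟩) 0
          (l (x j.castSucc) (x i)) = (fun k : Fin (r + 1) => if k.val = 0 then l (x j.castSucc) (x i)
            else x ⟨ceIdx j.val i.val k.val % (r + 1 + 1), Nat.mod_lt _ (Nat.succ_pos _)⟩) := by
      rw [Function.update_eq_self_iff]; simp
    rw [hself, hs]
    unfold ceTerm
    rw [if_neg (not_lt.2 h.le), if_pos h, pow_add, smul_eq_mul]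
    simp only [Fin.val_castSucc]
    ring
  · have hs : i.succAbove j = j.succ := Fin.succAbove_of_le_castSucc _ _ h
    have hji : i.val ≤ j.val := h
    have hvec : Matrix.vecCons (l (x i) (x (i.succAbove j))) (j.removeNth (i.removeNth x)) =
        (fun k : Fin (r + 1) => if k.val = 0 then l (x i) (x j.succ)
            else x ⟨ceIdx i.val j.succ.val k.val % (r + 1 + 1),
              Nat.mod_lt _ (Nat.succ_pos _)⟩) := by
      funext k
      refine Fin.cases ?_ (fun k => ?_) k
      · simp [hs]
      · rw [Matrix.cons_val_succ]
        simp only [Fin.val_succ, Nat.succ_ne_zero, if_false, Fin.removeNth]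
        congr 1
        apply Fin.ext
        have hk := k.2
        have hi := i.2
        simp only [Fin.succAbove, Fin.lt_def, Fin.val_castSucc, ceIdx]
        split_ifs <;> simp_all [Nat.mod_eq_of_lt] <;> (try rw [Nat.mod_eq_of_lt]) <;> omega
    have hlt : i < j.succ := by rw [Fin.lt_def, Fin.val_succ]; omega
    rw [hvec, hs]
    unfold ceTerm
    rw [if_pos hlt, if_neg (not_lt.2 hlt.le), pow_add]
    have h3 : (-1 : ℝ) ^ j.succ.val = (-1 : ℝ) ^ j.val * (-1) := by rw [Fin.val_succ, pow_succ]
    rw [h3]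
    ring

/-- The differential of an alternating cochain is alternating. -/
theorem exists_alt {n : ℕ} (q : ℕ) {l : LieLawSpace n} (hl : ∀ X, l X X = 0)
    (ω : AlternatingMap ℝ (Fin n → ℝ) ℝ (Fin q)) :
    ∃ η : AlternatingMap ℝ (Fin n → ℝ) ℝ (Fin (q + 1)), ∀ x, η x = ceDiff q l ω x := by
  cases q with
  | zero =>
    refine ⟨0, fun x => ?_⟩
    simp [ceDiff]
  | succ r =>
    let F : (Fin n → ℝ) →ₗ[ℝ] AlternatingMap ℝ (Fin n → ℝ) ℝ (Fin (r + 1)) :=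
      { toFun := fun X => AlternatingMap.alternatizeUncurryFin (ω.curryLeft ∘ₗ l X)
        map_add' := fun X Y => by
          rw [map_add, LinearMap.comp_add, AlternatingMap.alternatizeUncurryFin_add]
        map_smul' := fun c X => by
          rw [map_smul, LinearMap.comp_smul, AlternatingMap.alternatizeUncurryFin_smul]
          rfl }
    refine ⟨(-(1 / 2 : ℝ)) • AlternatingMap.alternatizeUncurryFin F, fun x => ?_⟩
    have hF : AlternatingMap.alternatizeUncurryFin F x =
        ∑ i : Fin (r + 1 + 1), ∑ j : Fin (r + 1),
          -(ceTerm r l ω x i (i.succAbove j) + ceTerm r l ω x (i.succAbove j) i) := by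
      rw [AlternatingMap.alternatizeUncurryFin_apply]
      refine Finset.sum_congr rfl fun i _ => ?_
      change _ • (AlternatingMap.alternatizeUncurryFin (ω.curryLeft ∘ₗ l (x i))) _ = _
      rw [AlternatingMap.alternatizeUncurryFin_apply, Finset.smul_sum]
      refine Finset.sum_congr rfl fun j _ => ?_
      rw [← ceTerm_key r hl]
      simp only [LinearMap.comp_apply, AlternatingMap.curryLeft_apply_apply, zsmul_eq_mul]
      push_cast
      rfl
    have hd : ceDiff (r + 1) l ω x = ∑ i, ∑ j, ceTerm r l ω x i j := rfl
    have hT : ∀ i, ceTerm r l ω x i i = 0 := fun i => by simp [ceTerm]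
    have h1 : ∑ i, ∑ j, ceTerm r l ω x i j =
        ∑ i : Fin (r + 1 + 1), ∑ j : Fin (r + 1), ceTerm r l ω x i (i.succAbove j) := by
      refine Finset.sum_congr rfl fun i _ => ?_
      rw [Fin.sum_univ_succAbove _ i, hT, zero_add]
    have h2 : ∑ i, ∑ j, ceTerm r l ω x i j =
        ∑ i : Fin (r + 1 + 1), ∑ j : Fin (r + 1), ceTerm r l ω x (i.succAbove j) i := by
      rw [Finset.sum_comm]
      refine Finset.sum_congr rfl fun i _ => ?_
      rw [Fin.sum_univ_succAbove _ i, hT, zero_add]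
    rw [AlternatingMap.smul_apply, hF, hd]
    simp only [Finset.sum_neg_distrib, Finset.sum_add_distrib]
    rw [← h1, ← h2, smul_eq_mul]
    ring

/-- Rank-nullity for the differential. -/
theorem finrank_cobound {n : ℕ} (q : ℕ) {l : LieLawSpace n} (hl : ∀ X, l X X = 0) :
    finrank ℝ (ceCoboundaries n (q + 1) l) + finrank ℝ (ceCocycles n q l) =
      finrank ℝ (AlternatingMap ℝ (Fin n → ℝ) ℝ (Fin q)) := by
  choose d hd using fun ω => exists_alt q hl ω
  have hd' : ∀ ω, (⇑(d ω) : _ → ℝ) = ceD n q l ω := fun ω => funext (hd ω)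
  let dL : AlternatingMap ℝ (Fin n → ℝ) ℝ (Fin q) →ₗ[ℝ]
      AlternatingMap ℝ (Fin n → ℝ) ℝ (Fin (q + 1)) :=
    { toFun := d
      map_add' := fun a b => by
        apply DFunLike.coe_injective
        rw [hd', map_add, ← hd', ← hd']; rfl
      map_smul' := fun c a => by
        apply DFunLike.coe_injective
        rw [hd', map_smul, ← hd']; rfl }
  have hdL : ∀ ω x, dL ω x = ceDiff q l ω x := hd
  have hk : LinearMap.ker dL = ceCocycles n q l := by
    ext ω
    rw [LinearMap.mem_ker]
    change _ ↔ ∀ x, ceDiff q l ω x = 0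
    constructor
    · intro h x
      rw [← hdL, h]; rfl
    · intro h
      ext x
      rw [hdL, h]; rfl
  have hr : LinearMap.range dL = ceCoboundaries n (q + 1) l := by
    ext ω
    rw [LinearMap.mem_range]
    change _ ↔ ∃ η : AlternatingMap ℝ (Fin n → ℝ) ℝ (Fin q), ∀ x, ω x = ceDiff q l η x
    constructor
    · rintro ⟨η, rfl⟩
      exact ⟨η, fun x => hdL η x⟩
    · rintro ⟨η, h⟩
      refine ⟨η, ?_⟩
      ext x
      rw [hdL, h]
  rw [← hk, ← hr]
  exact LinearMap.finrank_range_add_finrank_ker dL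

end Aux

/-- Upper semicontinuity of Betti numbers along Zariski degenerations: if a Lie algebra
law `mu` lies in the Zariski closure of the orbit of `lam₀`, then
`dim H^p(lam₀, ℝ) ≤ dim H^p(mu, ℝ)` for every `p`. -/
theorem stmt_12 (n : ℕ) (lam₀ mu : LieLawSpace n)
    (h₀ : IsLieLaw lam₀) (hmu : IsLieLaw mu)
    (hdeg : mu ∈ zariskiClosure (lawOrbit lam₀)) :
    ∀ p : ℕ, lawBetti n p lam₀ ≤ lawBetti n p mu := by
  intro p
  unfold lawBetti
  have hZ := finrank_cocycles_le p hdeg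
  cases p with
  | zero =>
    exact Nat.sub_le_sub_right hZ _
  | succ q =>
    have hZ' := finrank_cocycles_le q hdeg
    have h1 := finrank_cobound q h₀.1
    have h2 := finrank_cobound q hmu.1
    omega

end
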